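/- For all g, h in S_n acting on V = F^n by permuting basis vectors, the absolute reflection length satisfies ℓ(g) = codim V^g = n − dim_F V^g; moreover, if ℓ(g) + ℓ(h) = ℓ(gh), then V^g ∩ V^h = V^{gh}. -/

import Mathlib

noncomputable section

/-- The permutation action of `g ∈ S_n` on `V = F^n`, permuting the standard basis
vectors: `pAct g (Pi.single i 1) = Pi.single (g i) 1`. -/
def pAct {F : Type} [Field F] {n : ℕ} (g : Equiv.Perm (Fin n)) :
    (Fin n → F) →ₗ[F] (Fin n → F) where
  toFun v := fun j => v (g.symm j)
  map_add' _ _ := rfl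
  map_smul' _ _ := rfl

/-- The fixed-point subspace `V^g = {v ∈ V : ᵍv = v}`. -/
def fixedSpace (F : Type) [Field F] {n : ℕ} (g : Equiv.Perm (Fin n)) :
    Submodule F (Fin n → F) :=
  LinearMap.ker ((pAct g - LinearMap.id : (Fin n → F) →ₗ[F] (Fin n → F)))

/-- The absolute reflection length of a permutation: the minimal number of
transpositions needed to express it as a product of transpositions. -/
def reflLen {n : ℕ} (g : Equiv.Perm (Fin n)) : ℕ :=
  sInf {k : ℕ | ∃ L : List (Equiv.Perm (Fin n)),
    L.length = k ∧ (∀ t ∈ L, t.IsSwap) ∧ L.prod = g}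

theorem mem_fixedSpace_iff {F : Type} [Field F] {n : ℕ} (g : Equiv.Perm (Fin n))
    (v : Fin n → F) : v ∈ fixedSpace F g ↔ ∀ i, v (g i) = v i := by
  unfold fixedSpace
  rw [LinearMap.mem_ker, LinearMap.sub_apply, sub_eq_zero]
  constructor
  · intro h i
    have := congrFun h (g i)
    simpa [pAct] using this.symm
  · intro h
    funext j
    have := h (g.symm j)
    simpa [pAct] using this.symm

theorem fixedSpace_inf_le {F : Type} [Field F] {n : ℕ} (g h : Equiv.Perm (Fin n)) :
    fixedSpace F g ⊓ fixedSpace F h ≤ fixedSpace F (g * h) := by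
  rintro v ⟨hg, hh⟩
  have hg' := (mem_fixedSpace_iff g v).1 hg
  have hh' := (mem_fixedSpace_iff h v).1 hh
  rw [mem_fixedSpace_iff]
  intro i
  rw [Equiv.Perm.mul_apply, hg', hh']

theorem finrank_fixed_le {F : Type} [Field F] {n : ℕ} (g : Equiv.Perm (Fin n)) :
    Module.finrank F (fixedSpace F g) ≤ n := by
  simpa using Submodule.finrank_le (fixedSpace F g)

theorem finrank_fixed_inf {F : Type} [Field F] {n : ℕ} (g h : Equiv.Perm (Fin n)) :
    Module.finrank F (fixedSpace F g) + Module.finrank F (fixedSpace F h) ≤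
      n + Module.finrank F (fixedSpace F g ⊓ fixedSpace F h : Submodule F (Fin n → F)) := by
  have h1 := Submodule.finrank_sup_add_finrank_inf_eq (fixedSpace F g) (fixedSpace F h)
  have h2 : Module.finrank F (fixedSpace F g ⊔ fixedSpace F h : Submodule F (Fin n → F)) ≤ n := by
    simpa using Submodule.finrank_le (fixedSpace F g ⊔ fixedSpace F h)
  omega

theorem finrank_fixed_swap {F : Type} [Field F] {n : ℕ} (t : Equiv.Perm (Fin n))
    (ht : t.IsSwap) : n ≤ Module.finrank F (fixedSpace F t) + 1 := by
  obtain ⟨a, b, hab, rfl⟩ := ht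
  let f : (Fin n → F) →ₗ[F] F :=
    LinearMap.proj (R := F) (φ := fun _ : Fin n => F) a -
      LinearMap.proj (R := F) (φ := fun _ : Fin n => F) b
  have h1 := LinearMap.finrank_range_add_finrank_ker f
  have h2 : Module.finrank F (LinearMap.range f) ≤ 1 := by
    simpa using Submodule.finrank_le (LinearMap.range f)
  have h3 : LinearMap.ker f ≤ fixedSpace F (Equiv.swap a b) := by
    intro v hv
    have hv' : v a = v b := by simpa [f, sub_eq_zero] using hv
    rw [mem_fixedSpace_iff]
    intro i
    rw [Equiv.swap_apply_def]
    split_ifs with p q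
    · rw [p, hv']
    · rw [q, hv']
    · rfl
  have h4 := Submodule.finrank_mono h3
  simp at h1
  omega

theorem finrank_fixed_one {F : Type} [Field F] {n : ℕ} :
    Module.finrank F (fixedSpace F (1 : Equiv.Perm (Fin n))) = n := by
  have : fixedSpace F (1 : Equiv.Perm (Fin n)) = ⊤ := by
    ext v
    simp [mem_fixedSpace_iff]
  rw [this]
  simp

theorem finrank_fixed_list {F : Type} [Field F] {n : ℕ} (L : List (Equiv.Perm (Fin n)))
    (hL : ∀ t ∈ L, t.IsSwap) : n ≤ Module.finrank F (fixedSpace F L.prod) + L.length := by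
  induction L with
  | nil =>
    rw [List.prod_nil, finrank_fixed_one]
    simp
  | cons t L ih =>
    have h1 := ih (fun s hs => hL s (List.mem_cons_of_mem _ hs))
    have h2 := finrank_fixed_swap (F := F) t (hL t List.mem_cons_self)
    have h3 := finrank_fixed_inf (F := F) t L.prod
    have h4 := Submodule.finrank_mono (fixedSpace_inf_le (F := F) t L.prod)
    rw [List.prod_cons, List.length_cons]
    omega

theorem exists_short_list (F : Type) [Field F] {n : ℕ} (k : ℕ) : ∀ g : Equiv.Perm (Fin n),
    n ≤ Module.finrank F (fixedSpace F g) + k →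
    ∃ L : List (Equiv.Perm (Fin n)), L.length ≤ k ∧ (∀ t ∈ L, t.IsSwap) ∧ L.prod = g := by
  induction k with
  | zero =>
    intro g hg
    refine ⟨[], le_rfl, by simp, ?_⟩
    have h1 : fixedSpace F g = ⊤ := by
      apply Submodule.eq_top_of_finrank_eq
      have := finrank_fixed_le (F := F) g
      simp
      omega
    rw [List.prod_nil]
    symm
    ext x
    by_contra hx
    have h2 : (Pi.single x 1 : Fin n → F) ∈ fixedSpace F g := h1 ▸ Submodule.mem_top
    have h3 := (mem_fixedSpace_iff g _).1 h2 x
    have hne : g x ≠ x := fun h => hx (by simp [h])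
    simp [hne] at h3
  | succ k ih =>
    intro g hg
    by_cases h1 : g = 1
    · exact ⟨[], by simp, by simp, by simp [h1]⟩
    obtain ⟨x, hx⟩ : ∃ x, g x ≠ x := by
      by_contra! hc
      exact h1 (Equiv.ext hc)
    have hlt : fixedSpace F g < fixedSpace F (Equiv.swap x (g x) * g) := by
      refine lt_of_le_of_ne ?_ ?_
      · intro v hv
        rw [mem_fixedSpace_iff] at hv ⊢
        intro i
        rw [Equiv.Perm.mul_apply, Equiv.swap_apply_def]
        split_ifs with p q
        · rw [← hv i, p, hv x]
        · rw [← hv i, q, hv x]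
        · exact hv i
      · intro he
        have h2 : (Pi.single x 1 : Fin n → F) ∈ fixedSpace F g := by
          rw [he, mem_fixedSpace_iff]
          intro i
          by_cases hi : i = x
          · subst hi
            simp
          · have : (Equiv.swap x (g x) * g) i ≠ x := by
              intro h
              apply hi
              apply (Equiv.swap x (g x) * g).injective
              rw [h]
              simp
            rw [Pi.single_eq_of_ne this, Pi.single_eq_of_ne hi]
        have h3 := (mem_fixedSpace_iff g _).1 h2 x
        simp [hx] at h3
    have h2 := Submodule.finrank_lt_finrank_of_lt hlt
    obtain ⟨L, hl, hs, hp⟩ := ih (Equiv.swap x (g x) * g) (by omega)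
    refine ⟨Equiv.swap x (g x) :: L, by simpa using hl, ?_, ?_⟩
    · intro t ht
      rcases List.mem_cons.1 ht with rfl | ht
      · exact ⟨x, g x, hx.symm, rfl⟩
      · exact hs t ht
    · rw [List.prod_cons, hp, ← mul_assoc, Equiv.swap_mul_self, one_mul]

theorem reflLen_eq (F : Type) [Field F] {n : ℕ} (g : Equiv.Perm (Fin n)) :
    reflLen g = n - Module.finrank F (fixedSpace F g) := by
  obtain ⟨L, hl, hs, hp⟩ := exists_short_list F (n - Module.finrank F (fixedSpace F g)) g (by omega)
  apply le_antisymm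
  · refine le_trans ?_ hl
    unfold reflLen
    exact Nat.sInf_le ⟨L, rfl, hs, hp⟩
  · obtain ⟨L', hl', hs', hp'⟩ := Nat.sInf_mem (s := {k : ℕ | ∃ L : List (Equiv.Perm (Fin n)),
      L.length = k ∧ (∀ t ∈ L, t.IsSwap) ∧ L.prod = g}) ⟨_, L, rfl, hs, hp⟩
    have := finrank_fixed_list (F := F) L' hs'
    rw [hp'] at this
    unfold reflLen
    omega

/-- for the symmetric group `S_n` acting on `V = F^n` by permuting basis
vectors, the absolute reflection length satisfies `ℓ(g) = codim V^g = n − dim V^g`;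
moreover if `ℓ(g) + ℓ(h) = ℓ(gh)` then `V^g ∩ V^h = V^{gh}`. -/
theorem stmt2 {F : Type} [Field F] {n : ℕ} (hchar : ringChar F ≠ 2)
    (g h : Equiv.Perm (Fin n)) :
    reflLen g = n - Module.finrank F (fixedSpace F g) ∧
    (reflLen g + reflLen h = reflLen (g * h) →
      fixedSpace F g ⊓ fixedSpace F h = fixedSpace F (g * h)) := by
  refine ⟨reflLen_eq F g, fun H => ?_⟩
  rw [reflLen_eq F, reflLen_eq F, reflLen_eq F] at H
  apply Submodule.eq_of_le_of_finrank_le (fixedSpace_inf_le g h)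
  have h1 := finrank_fixed_inf (F := F) g h
  have h2 := finrank_fixed_le (F := F) g
  have h3 := finrank_fixed_le (F := F) h
  have h4 := finrank_fixed_le (F := F) (g * h)
  omega
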